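/- Let M > 1. There exist constants c₀, C > 0 such that for all L > 0, μ > 0 and E_B < 0 with L²|E_B| ≥ 1 and μ/|E_B| ≥ c₀, every e_P < 0 solving the polaron equation and every λ ≤ E₀(μ) + e_P satisfy (1/L²) Σ_{k ∈ Λ_L, |k|² ≤ μ} [ G(k, −e_P − |k|²) − G(0, E₀(μ) − |k|² − λ) ] ≤ C μ. -/

import Mathlib

open Real MeasureTheory Set

/-- The momentum lattice point `(2π/L)·z` for `z ∈ ℤ²`. -/
noncomputable def kvec (L : ℝ) (z : ℤ × ℤ) : ℝ × ℝ :=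
  ((2 * Real.pi / L) * z.1, (2 * Real.pi / L) * z.2)

/-- Euclidean norm squared on `ℝ²`. -/
noncomputable def nsq (v : ℝ × ℝ) : ℝ := v.1 ^ 2 + v.2 ^ 2

/-- `χ_{(μ,∞)}(s)`. -/
noncomputable def chi (μ s : ℝ) : ℝ := if μ < s then 1 else 0

/-- The function `G(q,τ)` (with `m = 1 + 1/M`). -/
noncomputable def Gfun (M L E_B μ : ℝ) (q : ℝ × ℝ) (τ : ℝ) : ℝ :=
  (1 / L ^ 2) * ∑' z : ℤ × ℤ,
    (1 / ((1 + 1 / M) * nsq (kvec L z) + |E_B|)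
      - chi μ (nsq (kvec L z)) / ((1 / M) * nsq (q - kvec L z) + nsq (kvec L z) + τ))

/-- The free Fermi energy `E₀(μ) = Σ_{|k|² ≤ μ} |k|²`. -/
noncomputable def E0 (L μ : ℝ) : ℝ :=
  ∑' z : ℤ × ℤ, if nsq (kvec L z) ≤ μ then nsq (kvec L z) else 0

/-- The particle number `N(μ) = card{k ∈ Λ_L : |k|² ≤ μ}`. -/
noncomputable def Nmu (L μ : ℝ) : ℕ := Nat.card {z : ℤ × ℤ // nsq (kvec L z) ≤ μ}

/-- `e` solves the polaron equation. -/
def PolaronEq (M L E_B μ e : ℝ) : Prop :=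
  e = -((1 / L ^ 2) * ∑' z : ℤ × ℤ,
    if nsq (kvec L z) ≤ μ then
      1 / Gfun M L E_B μ (kvec L z) (-(nsq (kvec L z)) - e) else 0)

/-- Squared Euclidean norm of an integer point. -/
noncomputable def sqNorm (z : ℤ × ℤ) : ℝ := (z.1 : ℝ) ^ 2 + (z.2 : ℝ) ^ 2

/-- Sup norm of an integer point. -/
def supNorm (z : ℤ × ℤ) : ℕ := max z.1.natAbs z.2.natAbs

lemma sqNorm_nonneg (z : ℤ × ℤ) : 0 ≤ sqNorm z := by unfold sqNorm; positivity

lemma supNorm_sq_le_sqNorm (z : ℤ × ℤ) : (supNorm z : ℝ) ^ 2 ≤ sqNorm z := by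
  have h1 : ((z.1.natAbs : ℕ) : ℝ) ^ 2 = (z.1 : ℝ) ^ 2 := by
    rw [Nat.cast_natAbs, Int.cast_abs, sq_abs]
  have h2 : ((z.2.natAbs : ℕ) : ℝ) ^ 2 = (z.2 : ℝ) ^ 2 := by
    rw [Nat.cast_natAbs, Int.cast_abs, sq_abs]
  unfold supNorm sqNorm
  rcases max_choice z.1.natAbs z.2.natAbs with h | h <;> rw [h]
  · nlinarith [sq_nonneg (z.2 : ℝ)]
  · nlinarith [sq_nonneg (z.1 : ℝ)]

lemma nsq_kvec (L : ℝ) (z : ℤ × ℤ) :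
    nsq (kvec L z) = (2 * Real.pi / L) ^ 2 * sqNorm z := by
  simp only [nsq, kvec, sqNorm]; ring

lemma kvec_zero (L : ℝ) : kvec L 0 = 0 := by simp [kvec]

lemma kvec_sub (L : ℝ) (w z : ℤ × ℤ) : kvec L w - kvec L z = kvec L (w - z) := by
  simp only [kvec, Prod.mk_sub_mk, Prod.fst_sub, Prod.snd_sub, Int.cast_sub]
  ext <;> simp only <;> ring

lemma card_filter_supNorm_le (s : Finset (ℤ × ℤ)) {n : ℕ} (hn : n ≠ 0) :
    ((s.filter fun v => supNorm v = n).card : ℝ) ≤ 8 * n := by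
  have h : (s.filter fun v => supNorm v = n) ⊆ (Finset.box n : Finset (ℤ × ℤ)) := by
    intro v hv
    rw [Int.mem_box]
    exact (Finset.mem_filter.mp hv).2
  have := Finset.card_le_card h
  rw [Int.card_box hn] at this
  exact_mod_cast this

lemma sum_supNorm_le {c R : ℝ} (hc : 0 ≤ c) (hR : 0 < R) (s : Finset (ℤ × ℤ)) :
    ∑ v ∈ s, c / (supNorm v * (R + supNorm v) ^ 2) ≤ 8 * c / R := by
  set N := s.sup supNorm
  have hmap : ∀ v ∈ s, supNorm v ∈ Finset.range (N + 1) := fun v hv =>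
    Finset.mem_range.mpr (Nat.lt_succ_of_le (Finset.le_sup hv))
  rw [← Finset.sum_fiberwise_of_maps_to hmap]
  have hfib : ∀ n ∈ Finset.range (N + 1),
      ∑ v ∈ s with supNorm v = n, c / (supNorm v * (R + supNorm v) ^ 2)
        ≤ 8 * (n * (c / (n * (R + n) ^ 2))) := by
    intro n _
    rw [Finset.sum_congr rfl (g := fun _ => c / (n * (R + n) ^ 2))
      (fun v hv => by rw [(Finset.mem_filter.mp hv).2]), Finset.sum_const, nsmul_eq_mul]
    rcases eq_or_ne n 0 with rfl | hn
    · simp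
    · have := mul_le_mul_of_nonneg_right (card_filter_supNorm_le s hn)
        (show 0 ≤ c / (n * (R + n) ^ 2) by positivity)
      linarith
  refine (Finset.sum_le_sum hfib).trans ?_
  have key : ∀ K : ℕ, ∑ n ∈ Finset.range (K + 1), 8 * ((n : ℝ) * (c / (n * (R + n) ^ 2)))
      ≤ 8 * c * (1 / R - 1 / (R + K)) := by
    intro K
    induction K with
    | zero => simp
    | succ K ih =>
      rw [Finset.sum_range_succ]
      have e : ((K + 1 : ℕ) : ℝ) * (c / (((K + 1 : ℕ) : ℝ) * (R + ((K + 1 : ℕ) : ℝ)) ^ 2))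
          = c * (1 / (R + K + 1) ^ 2) := by
        push_cast; field_simp; ring
      have h : 1 / (R + K + 1) ^ 2 ≤ 1 / (R + K) - 1 / (R + K + 1) := by
        rw [div_sub_div _ _ (by positivity) (by positivity),
          div_le_div_iff₀ (by positivity) (by positivity)]
        have : (0 : ℝ) < R + K := by positivity
        nlinarith
      rw [e]
      push_cast
      have := mul_le_mul_of_nonneg_left h hc
      rw [← add_assoc]
      linarith
  refine (key N).trans ?_
  have : 1 / R - 1 / (R + N) ≤ 1 / R := by
    have : 0 ≤ 1 / (R + (N : ℝ)) := by positivity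
    linarith
  have := mul_le_mul_of_nonneg_left this hc
  have e : 8 * c / R = 8 * (c * (1 / R)) := by ring
  rw [e]; linarith

lemma summable_supNorm {c R : ℝ} (hc : 0 ≤ c) (hR : 0 < R) :
    Summable fun v : ℤ × ℤ => c / (supNorm v * (R + supNorm v) ^ 2) :=
  summable_of_sum_le (fun v => by positivity) (sum_supNorm_le hc hR)

lemma tsum_supNorm_le {c R : ℝ} (hc : 0 ≤ c) (hR : 0 < R) :
    ∑' v : ℤ × ℤ, c / (supNorm v * (R + supNorm v) ^ 2) ≤ 8 * c / R :=
  (summable_supNorm hc hR).tsum_le_of_sum_le (sum_supNorm_le hc hR)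

/-- The integer points of the closed Euclidean disc of radius `R`. -/
noncomputable def latticeDisc (R : ℝ) : Finset (ℤ × ℤ) :=
  open Classical in
  (Finset.Icc (-⌊R⌋) ⌊R⌋ ×ˢ Finset.Icc (-⌊R⌋) ⌊R⌋).filter fun z => sqNorm z ≤ R ^ 2

lemma mem_Icc_floor {R : ℝ} (hR : 0 ≤ R) {x : ℤ} (h : (x : ℝ) ^ 2 ≤ R ^ 2) :
    x ∈ Finset.Icc (-⌊R⌋) ⌊R⌋ := by
  have := abs_le.mp (abs_le_of_sq_le_sq h hR)
  rw [Finset.mem_Icc, neg_le, Int.le_floor, Int.le_floor]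
  push_cast
  exact ⟨by linarith, by linarith⟩

lemma mem_latticeDisc {R : ℝ} (hR : 0 ≤ R) {z : ℤ × ℤ} :
    z ∈ latticeDisc R ↔ sqNorm z ≤ R ^ 2 := by
  classical
  unfold latticeDisc
  rw [Finset.mem_filter, Finset.mem_product]
  refine ⟨fun h => h.2, fun h => ⟨⟨mem_Icc_floor hR ?_, mem_Icc_floor hR ?_⟩, h⟩⟩
  · unfold sqNorm at h; nlinarith [sq_nonneg (z.2 : ℝ)]
  · unfold sqNorm at h; nlinarith [sq_nonneg (z.1 : ℝ)]

lemma card_Icc_floor_le {R : ℝ} (hR : 1 ≤ R) :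
    ((Finset.Icc (-⌊R⌋) ⌊R⌋).card : ℝ) ≤ 3 * R := by
  have h0 : 0 ≤ ⌊R⌋ := Int.floor_nonneg.mpr (by linarith)
  rw [Int.card_Icc]
  have : ((⌊R⌋ + 1 - -⌊R⌋).toNat : ℤ) = 2 * ⌊R⌋ + 1 := by omega
  have h2 : ((⌊R⌋ + 1 - -⌊R⌋).toNat : ℝ) = 2 * (⌊R⌋ : ℝ) + 1 := by exact_mod_cast this
  rw [h2]
  linarith [Int.floor_le R]

lemma card_latticeDisc_le {R : ℝ} (hR : 1 ≤ R) : ((latticeDisc R).card : ℝ) ≤ 9 * R ^ 2 := by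
  classical
  have h : (latticeDisc R).card
      ≤ (Finset.Icc (-⌊R⌋) ⌊R⌋).card * (Finset.Icc (-⌊R⌋) ⌊R⌋).card := by
    rw [← Finset.card_product]
    exact Finset.card_le_card (Finset.filter_subset _ _)
  have h' : ((latticeDisc R).card : ℝ)
      ≤ (Finset.Icc (-⌊R⌋) ⌊R⌋).card * (Finset.Icc (-⌊R⌋) ⌊R⌋).card := by exact_mod_cast h
  have := card_Icc_floor_le hR
  have h0 : (0 : ℝ) ≤ (Finset.Icc (-⌊R⌋) ⌊R⌋).card := by positivity
  nlinarith

/-- The points of the disc which leave it under translation by `v`. -/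
noncomputable def exitSet (R : ℝ) (v : ℤ × ℤ) : Finset (ℤ × ℤ) :=
  open Classical in (latticeDisc R).filter fun w => w + v ∉ latticeDisc R

lemma mem_exitSet {R : ℝ} {v w : ℤ × ℤ} :
    w ∈ exitSet R v ↔ w ∈ latticeDisc R ∧ w + v ∉ latticeDisc R := by
  classical
  unfold exitSet
  rw [Finset.mem_filter]

/-- A chord of the disc parallel to the first axis contains at most one exiting point from each
residue class modulo the horizontal displacement. -/
lemma exit_unique {x x' a : ℤ} {t : ℝ} (ha : a ≠ 0) (hx : (x : ℝ) ^ 2 ≤ t)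
    (hx' : (x' : ℝ) ^ 2 ≤ t) (hxa : t < ((x + a : ℤ) : ℝ) ^ 2)
    (hxa' : t < ((x' + a : ℤ) : ℝ) ^ 2) (hmod : x % a = x' % a) : x = x' := by
  have hd : a ∣ x' - x := Int.ModEq.dvd hmod
  obtain ⟨j, hj⟩ := hd
  have conv : ∀ y y' u : ℤ, (y : ℝ) ^ 2 ≤ t → (y' : ℝ) ^ 2 ≤ t → y ≤ u → u ≤ y' →
      (u : ℝ) ^ 2 ≤ t := by
    intro y y' u h h' hyu huy
    have h1 : (y : ℝ) ≤ u := by exact_mod_cast hyu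
    have h2 : (u : ℝ) ≤ y' := by exact_mod_cast huy
    rcases le_total 0 (u : ℝ) with h3 | h3 <;> nlinarith
  by_contra hne
  have hj0 : j ≠ 0 := by
    rintro rfl
    apply hne; linarith
  rcases lt_or_gt_of_ne ha with ha' | ha' <;> rcases lt_or_gt_of_ne hj0 with hj' | hj'
  · exact absurd (conv x x' (x' + a) hx hx' (by nlinarith) (by omega)) (not_le.mpr hxa')
  · exact absurd (conv x' x (x + a) hx' hx (by nlinarith) (by omega)) (not_le.mpr hxa)
  · exact absurd (conv x' x (x' + a) hx' hx (by omega) (by nlinarith)) (not_le.mpr hxa')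
  · exact absurd (conv x x' (x + a) hx hx' (by omega) (by nlinarith)) (not_le.mpr hxa)

lemma card_exitSet_fst_le {R : ℝ} (hR : 1 ≤ R) (a : ℤ) :
    ((exitSet R (a, 0)).card : ℝ) ≤ 3 * R * a.natAbs := by
  have hR0 : 0 ≤ R := by linarith
  rcases eq_or_ne a 0 with rfl | ha
  · have : exitSet R (0, 0) = ∅ := by
      rw [Finset.eq_empty_iff_forall_notMem]
      intro w hw
      obtain ⟨h1, h2⟩ := mem_exitSet.mp hw
      exact h2 (by rwa [show ((0, 0) : ℤ × ℤ) = 0 from rfl, add_zero])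
    simp [this]
  have h : (exitSet R (a, 0)).card
      ≤ ((Finset.Icc (-⌊R⌋) ⌊R⌋) ×ˢ (Finset.Ico 0 (a.natAbs : ℤ))).card := by
    refine Finset.card_le_card_of_injOn (fun w => (w.2, w.1 % a)) ?_ ?_
    · intro w hw
      obtain ⟨h1, -⟩ := mem_exitSet.mp hw
      rw [mem_latticeDisc hR0] at h1
      simp only [Finset.coe_product, Set.mem_prod, Finset.mem_coe]
      refine ⟨mem_Icc_floor hR0 ?_, ?_⟩
      · unfold sqNorm at h1; nlinarith [sq_nonneg (w.1 : ℝ)]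
      · rw [Finset.mem_Ico]
        exact ⟨Int.emod_nonneg _ ha, by
          rw [Int.natCast_natAbs]; exact Int.emod_lt_abs _ ha⟩
    · intro w hw w' hw' heq
      obtain ⟨h1, h2⟩ := mem_exitSet.mp hw
      obtain ⟨h1', h2'⟩ := mem_exitSet.mp hw'
      rw [mem_latticeDisc hR0] at h1 h2 h1' h2'
      simp only [Prod.mk.injEq] at heq
      obtain ⟨e2, e1⟩ := heq
      refine Prod.ext ?_ e2
      simp only [sqNorm, Prod.fst_add, Prod.snd_add, add_zero, not_le] at h1 h2 h1' h2'
      rw [← e2] at h1' h2'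
      exact exit_unique (t := R ^ 2 - (w.2 : ℝ) ^ 2) ha (by linarith) (by linarith)
        (by linarith) (by linarith) e1
  rw [Finset.card_product, Int.card_Ico] at h
  have h' : ((exitSet R (a, 0)).card : ℝ)
      ≤ (Finset.Icc (-⌊R⌋) ⌊R⌋).card * a.natAbs := by
    have e : ((a.natAbs : ℤ) - 0).toNat = a.natAbs := by omega
    rw [e] at h
    exact_mod_cast h
  exact h'.trans (mul_le_mul_of_nonneg_right (card_Icc_floor_le hR) (by positivity))

lemma card_exitSet_snd_le {R : ℝ} (hR : 1 ≤ R) (b : ℤ) :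
    ((exitSet R (0, b)).card : ℝ) ≤ 3 * R * b.natAbs := by
  have hR0 : 0 ≤ R := by linarith
  refine le_trans ?_ (card_exitSet_fst_le hR b)
  have hs : ∀ z : ℤ × ℤ, sqNorm z.swap = sqNorm z := fun z => by
    simp only [sqNorm, Prod.fst_swap, Prod.snd_swap]; ring
  have h := Finset.card_le_card_of_injOn (s := exitSet R (0, b)) (t := exitSet R (b, 0))
    Prod.swap ?_ Prod.swap_injective.injOn
  · exact_mod_cast h
  · intro w hw
    have hw' := mem_exitSet.mp hw
    refine mem_exitSet.mpr ?_
    rw [mem_latticeDisc hR0] at hw' ⊢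
    rw [mem_latticeDisc hR0] at hw' ⊢
    have e : w.swap + (b, 0) = (w + (0, b)).swap := by ext <;> simp
    rw [e, hs, hs]
    exact hw'

lemma card_exitSet_le {R : ℝ} (hR : 1 ≤ R) (v : ℤ × ℤ) :
    ((exitSet R v).card : ℝ) ≤ 18 * R ^ 2 * supNorm v / (R + supNorm v) := by
  classical
  have hR0 : 0 < R := by linarith
  have h1 : ((exitSet R v).card : ℝ) ≤ 9 * R ^ 2 := by
    refine le_trans ?_ (card_latticeDisc_le hR)
    exact_mod_cast Finset.card_le_card (Finset.filter_subset _ _)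
  have h2 : ((exitSet R v).card : ℝ) ≤ 6 * R * supNorm v := by
    have hsub : exitSet R v ⊆ exitSet R (v.1, 0) ∪
        (exitSet R (0, v.2)).image fun u => u - (v.1, 0) := by
      intro w hw
      obtain ⟨hw1, hw2⟩ := mem_exitSet.mp hw
      by_cases h : w + (v.1, 0) ∈ latticeDisc R
      · refine Finset.mem_union_right _ (Finset.mem_image.mpr ⟨w + (v.1, 0), ?_, by simp⟩)
        refine mem_exitSet.mpr ⟨h, ?_⟩
        have e : w + (v.1, 0) + (0, v.2) = w + v := by ext <;> simp
        rwa [e]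
      · exact Finset.mem_union_left _ (mem_exitSet.mpr ⟨hw1, h⟩)
    have hc : (exitSet R v).card ≤ (exitSet R (v.1, 0)).card + (exitSet R (0, v.2)).card :=
      (Finset.card_le_card hsub).trans ((Finset.card_union_le _ _).trans
        (Nat.add_le_add_left Finset.card_image_le _))
    have hc' : ((exitSet R v).card : ℝ)
        ≤ (exitSet R (v.1, 0)).card + (exitSet R (0, v.2)).card := by exact_mod_cast hc
    have ha := card_exitSet_fst_le hR v.1
    have hb := card_exitSet_snd_le hR v.2
    have hna : (v.1.natAbs : ℝ) ≤ supNorm v := by exact_mod_cast le_max_left _ _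
    have hnb : (v.2.natAbs : ℝ) ≤ supNorm v := by exact_mod_cast le_max_right _ _
    nlinarith
  have hn : (0 : ℝ) ≤ supNorm v := by positivity
  rw [le_div_iff₀ (by positivity)]
  nlinarith

/-- The summand of `Gfun`, in terms of integer points, with `κ = (2π/L)²` and `E = |E_B|`. -/
noncomputable def gTerm (M κ E μ : ℝ) (w : ℤ × ℤ) (τ : ℝ) (z : ℤ × ℤ) : ℝ :=
  1 / ((1 + 1 / M) * (κ * sqNorm z) + E)
    - chi μ (κ * sqNorm z) / ((1 / M) * (κ * sqNorm (w - z)) + κ * sqNorm z + τ)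

lemma Gfun_kvec (M L E_B μ : ℝ) (w : ℤ × ℤ) (τ : ℝ) :
    Gfun M L E_B μ (kvec L w) τ
      = (1 / L ^ 2) * ∑' z, gTerm M ((2 * Real.pi / L) ^ 2) |E_B| μ w τ z := by
  simp only [Gfun, gTerm, kvec_sub, nsq_kvec]

lemma abs_dot_le {w z : ℤ × ℤ} {a b : ℝ} (ha : 0 ≤ a) (hb : 0 ≤ b)
    (hw : sqNorm w ≤ a ^ 2) (hz : sqNorm z ≤ b ^ 2) :
    |(w.1 : ℝ) * z.1 + w.2 * z.2| ≤ a * b := by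
  refine abs_le_of_sq_le_sq ?_ (by positivity)
  have h : ((w.1 : ℝ) * z.1 + w.2 * z.2) ^ 2 ≤ sqNorm w * sqNorm z := by
    unfold sqNorm
    nlinarith [sq_nonneg ((w.1 : ℝ) * z.2 - w.2 * z.1)]
  rw [mul_pow]
  exact h.trans (mul_le_mul hw hz (sqNorm_nonneg z) (by positivity))

lemma sqNorm_sub (w z : ℤ × ℤ) :
    sqNorm (w - z) = sqNorm w + sqNorm z - 2 * ((w.1 : ℝ) * z.1 + w.2 * z.2) := by
  simp only [sqNorm, Prod.fst_sub, Prod.snd_sub, Int.cast_sub]; ring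

lemma eventually_lt_sqNorm (K : ℝ) : ∀ᶠ z : ℤ × ℤ in Filter.cofinite, K < sqNorm z := by
  rw [Filter.eventually_cofinite]
  refine (latticeDisc (√|K|)).finite_toSet.subset fun z hz => ?_
  rw [Set.mem_ofPred_eq, not_lt] at hz
  rw [Finset.mem_coe, mem_latticeDisc (Real.sqrt_nonneg _), Real.sq_sqrt (abs_nonneg _)]
  exact hz.trans (le_abs_self K)

lemma abs_gTerm_le {M κ E μ : ℝ} (hM : 0 < M) (hκ : 0 < κ) (hE : 0 ≤ E) (hμ : 0 ≤ μ)
    {w z : ℤ × ℤ} {τ r P : ℝ} (hP : 0 ≤ P) (hr1 : 1 ≤ r) (hr : κ * sqNorm z = r ^ 2)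
    (hw : κ * sqNorm w = P ^ 2) (hτ : μ + 2 * |τ| < r ^ 2) :
    |gTerm M κ E μ w τ z| ≤ 2 * ((P ^ 2 + 2 * P) / M + |τ| + E) / r ^ 3 := by
  have hr0 : 0 < r := by linarith
  have hchi : chi μ (κ * sqNorm z) = 1 := by
    rw [chi, if_pos]
    rw [hr]; linarith [abs_nonneg τ]
  have hwz : |κ * sqNorm (w - z) - r ^ 2| ≤ (P ^ 2 + 2 * P) * r := by
    have h := abs_dot_le (w := w) (z := z) (a := P / √κ) (b := r / √κ) (by positivity)
      (by positivity)
      (by rw [div_pow, Real.sq_sqrt hκ.le, ← hw]; field_simp; exact le_refl _)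
      (by rw [div_pow, Real.sq_sqrt hκ.le, ← hr]; field_simp; exact le_refl _)
    have e : P / √κ * (r / √κ) = P * r / κ := by
      rw [div_mul_div_comm, Real.mul_self_sqrt hκ.le]
    rw [e, le_div_iff₀ hκ] at h
    have e2 : κ * sqNorm (w - z) - r ^ 2
        = P ^ 2 - 2 * (((w.1 : ℝ) * z.1 + w.2 * z.2) * κ) := by
      rw [sqNorm_sub, ← hr, ← hw]; ring
    have h' : |((w.1 : ℝ) * z.1 + w.2 * z.2) * κ| ≤ P * r := by
      rwa [abs_mul, abs_of_pos hκ]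
    rw [e2]
    have := abs_le.mp h'
    rw [abs_le]
    constructor <;> nlinarith [sq_nonneg P]
  have hu : 0 ≤ κ * sqNorm (w - z) := mul_nonneg hκ.le (sqNorm_nonneg _)
  rw [gTerm, hchi, hr]
  generalize κ * sqNorm (w - z) = u at hwz hu
  have hA : r ^ 2 ≤ (1 + 1 / M) * r ^ 2 + E := by
    have : 0 ≤ 1 / M * r ^ 2 := by positivity
    linarith
  have hD : r ^ 2 / 2 ≤ 1 / M * u + r ^ 2 + τ := by
    have : 0 ≤ 1 / M * u := by positivity
    linarith [neg_abs_le τ]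
  have hr2 : 0 < r ^ 2 := by positivity
  have hA0 := hr2.trans_le hA
  have hD0 := (half_pos hr2).trans_le hD
  rw [div_sub_div _ _ hA0.ne' hD0.ne', abs_div, abs_of_pos (mul_pos hA0 hD0)]
  have hnum : |1 * (1 / M * u + r ^ 2 + τ) - ((1 + 1 / M) * r ^ 2 + E) * 1|
      ≤ ((P ^ 2 + 2 * P) / M + |τ| + E) * r := by
    have e : 1 * (1 / M * u + r ^ 2 + τ) - ((1 + 1 / M) * r ^ 2 + E) * 1
        = (u - r ^ 2) / M + τ - E := by ring
    have h1 : |(u - r ^ 2) / M| ≤ (P ^ 2 + 2 * P) / M * r := by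
      rw [abs_div, abs_of_pos hM, div_mul_eq_mul_div]
      exact div_le_div_of_nonneg_right hwz hM.le
    rw [e]
    have h1' := abs_le.mp h1
    have h2 : |τ| ≤ |τ| * r := le_mul_of_one_le_right (abs_nonneg _) hr1
    have h3 : E ≤ E * r := le_mul_of_one_le_right hE hr1
    have h4 := neg_abs_le τ
    have h5 := le_abs_self τ
    rw [abs_le]
    constructor <;> linarith
  refine (div_le_div₀ (by positivity) hnum (d := r ^ 2 * (r ^ 2 / 2)) (by positivity)
    (mul_le_mul hA hD (by positivity) hA0.le)).trans (le_of_eq ?_)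
  field_simp

lemma supNorm_pos_of_ne {v : ℤ × ℤ} (hv : v ≠ 0) : 0 < supNorm v := by
  by_contra h
  have h0 : max v.1.natAbs v.2.natAbs ≤ 0 := not_lt.mp h
  rw [max_le_iff, Nat.le_zero, Nat.le_zero, Int.natAbs_eq_zero, Int.natAbs_eq_zero] at h0
  exact hv (Prod.ext h0.1 h0.2)

lemma summable_gTerm {M κ E μ : ℝ} (hM : 0 < M) (hκ : 0 < κ) (hE : 0 ≤ E) (hμ : 0 ≤ μ)
    (w : ℤ × ℤ) (τ : ℝ) : Summable (gTerm M κ E μ w τ) := by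
  set P := √(κ * sqNorm w) with hPdef
  set K := 2 * ((P ^ 2 + 2 * P) / M + |τ| + E) with hK
  have hK0 : 0 ≤ K := by positivity
  have hκ' : 0 < √κ := Real.sqrt_pos.mpr hκ
  refine Summable.of_norm_bounded_eventually
    (summable_supNorm (c := K * (1 / √κ * (1 + 1 / √κ) ^ 2)) (R := 1) (by positivity) one_pos) ?_
  filter_upwards [eventually_lt_sqNorm ((1 + μ + 2 * |τ|) / κ)] with z hz
  rw [div_lt_iff₀ hκ, mul_comm] at hz
  have hs : 0 ≤ κ * sqNorm z := mul_nonneg hκ.le (sqNorm_nonneg z)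
  set r := √(κ * sqNorm z) with hr
  have hr2 : κ * sqNorm z = r ^ 2 := (Real.sq_sqrt hs).symm
  have hr1 : 1 ≤ r := by
    rw [hr, Real.one_le_sqrt]; linarith [abs_nonneg τ]
  rw [Real.norm_eq_abs]
  refine (abs_gTerm_le hM hκ hE hμ (Real.sqrt_nonneg _) hr1 hr2
    (Real.sq_sqrt (mul_nonneg hκ.le (sqNorm_nonneg w))).symm
    (by linarith [abs_nonneg τ])).trans ?_
  rw [← hPdef, ← hK]
  have hn : (supNorm z : ℝ) ≤ 1 / √κ * r := by
    rw [hr, Real.sqrt_mul hκ.le, one_div, inv_mul_cancel_left₀ hκ'.ne']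
    exact Real.le_sqrt_of_sq_le (supNorm_sq_le_sqNorm z)
  have hn0 : 0 < supNorm z := by
    refine supNorm_pos_of_ne ?_
    rintro rfl
    rw [show sqNorm 0 = 0 by simp [sqNorm]] at hz
    linarith [abs_nonneg τ]
  have hn0' : (0 : ℝ) < supNorm z := by exact_mod_cast hn0
  have hn1 : 1 + (supNorm z : ℝ) ≤ (1 + 1 / √κ) * r := by linarith
  have hprod : (supNorm z : ℝ) * (1 + supNorm z) ^ 2
      ≤ (1 / √κ * r) * ((1 + 1 / √κ) * r) ^ 2 := by gcongr
  rw [div_le_div_iff₀ (by positivity) (by positivity)]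
  calc K * ((supNorm z : ℝ) * (1 + supNorm z) ^ 2)
      ≤ K * ((1 / √κ * r) * ((1 + 1 / √κ) * r) ^ 2) := mul_le_mul_of_nonneg_left hprod hK0
    _ = _ := by ring

lemma gTerm_sub_eq_zero {M κ E μ R : ℝ} (hR : 0 ≤ R) (hκ : 0 < κ) (hμ : μ = κ * R ^ 2)
    {w z : ℤ × ℤ} (hz : z ∈ latticeDisc R) (τ τ' : ℝ) :
    gTerm M κ E μ w τ z - gTerm M κ E μ 0 τ' z = 0 := by
  have hchi : chi μ (κ * sqNorm z) = 0 := by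
    rw [chi, if_neg]
    rw [mem_latticeDisc hR] at hz
    rw [hμ, not_lt]
    exact mul_le_mul_of_nonneg_left hz hκ.le
  simp [gTerm, hchi]

lemma gTerm_sub_le {M κ E μ R : ℝ} (hM : 0 < M) (hR : 0 < R) (hκ : 0 < κ)
    (hμ : μ = κ * R ^ 2) {w v : ℤ × ℤ} (hw : w ∈ latticeDisc R) (hz : w + v ∉ latticeDisc R)
    {τ τ' : ℝ} (hτ : -(κ * sqNorm w) ≤ τ) (hττ' : τ ≤ τ') :
    gTerm M κ E μ w τ (w + v) - gTerm M κ E μ 0 τ' (w + v)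
      ≤ 9 * M * R / (κ * supNorm v ^ 2 * (R + supNorm v)) := by
  have hv : v ≠ 0 := by rintro rfl; exact hz (by rwa [add_zero])
  have hn : (0 : ℝ) < supNorm v := by exact_mod_cast supNorm_pos_of_ne hv
  rw [mem_latticeDisc hR.le] at hw hz
  rw [not_le] at hz
  have hV : sqNorm (w - (w + v)) = sqNorm v := by
    rw [sub_add_cancel_left]; simp [sqNorm]
  have hV2 : sqNorm v ≤ 2 * sqNorm w + 2 * sqNorm (w + v) := by
    simp only [sqNorm, Prod.fst_add, Prod.snd_add, Int.cast_add]
    nlinarith [sq_nonneg (2 * (w.1 : ℝ) + v.1), sq_nonneg (2 * (w.2 : ℝ) + v.2)]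
  have hsub := sqNorm_sub w (w + v)
  generalize w + v = z at *
  have hchi : chi μ (κ * sqNorm z) = 1 := by
    rw [chi, if_pos]
    rw [hμ]
    exact mul_lt_mul_of_pos_left hz hκ
  set t := √(sqNorm z) with ht
  have ht2 : sqNorm z = t ^ 2 := (Real.sq_sqrt (sqNorm_nonneg z)).symm
  have ht0 : 0 ≤ t := Real.sqrt_nonneg _
  have hRt : R ≤ t := by
    rw [ht2] at hz
    exact (lt_of_pow_lt_pow_left₀ 2 ht0 hz).le
  have htpos : 0 < t := hR.trans_le hRt
  have hdot := (abs_le.mp (abs_dot_le hR.le ht0 hw ht2.le)).1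
  have hnV := supNorm_sq_le_sqNorm v
  have hn2 : (supNorm v : ℝ) ≤ 2 * t :=
    le_of_sq_le_sq (by nlinarith) (by positivity)
  have h0z : sqNorm (0 - z) = sqNorm z := by simp [sqNorm]
  rw [gTerm, gTerm, hchi, hV, h0z]
  rw [hV] at hsub
  have hVpos : 0 < sqNorm v := (by positivity : (0 : ℝ) < (supNorm v : ℝ) ^ 2).trans_le hnV
  have hwz : κ * sqNorm w ≤ κ * sqNorm z := mul_le_mul_of_nonneg_left (hw.trans hz.le) hκ.le
  have hA : κ * t ^ 2 / M ≤ 1 / M * (κ * sqNorm z) + κ * sqNorm z + τ := by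
    have : κ * t ^ 2 / M = 1 / M * (κ * sqNorm z) := by rw [ht2]; ring
    linarith
  have hB : κ * sqNorm v / M ≤ 1 / M * (κ * sqNorm v) + κ * sqNorm z + τ := by
    have : κ * sqNorm v / M = 1 / M * (κ * sqNorm v) := by ring
    linarith
  have hA0 : 0 < 1 / M * (κ * sqNorm z) + κ * sqNorm z + τ :=
    lt_of_lt_of_le (by positivity) hA
  have hB0 : 0 < 1 / M * (κ * sqNorm v) + κ * sqNorm z + τ :=
    lt_of_lt_of_le (by positivity) hB
  have hA' : 1 / (1 / M * (κ * sqNorm z) + κ * sqNorm z + τ')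
      ≤ 1 / (1 / M * (κ * sqNorm z) + κ * sqNorm z + τ) :=
    one_div_le_one_div_of_le hA0 (by linarith)
  have hnum : 1 * (1 / M * (κ * sqNorm v) + κ * sqNorm z + τ)
      - (1 / M * (κ * sqNorm z) + κ * sqNorm z + τ) * 1 ≤ 3 * R * t * κ / M := by
    have e : 1 * (1 / M * (κ * sqNorm v) + κ * sqNorm z + τ)
      - (1 / M * (κ * sqNorm z) + κ * sqNorm z + τ) * 1
        = (sqNorm v - sqNorm z) * κ / M := by ring
    rw [e]
    have : sqNorm v - sqNorm z ≤ 3 * R * t := by nlinarith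
    gcongr
  have hkey : 1 / (1 / M * (κ * sqNorm z) + κ * sqNorm z + τ)
      - 1 / (1 / M * (κ * sqNorm v) + κ * sqNorm z + τ)
      ≤ 9 * M * R / (κ * supNorm v ^ 2 * (R + supNorm v)) := by
    rw [div_sub_div _ _ hA0.ne' hB0.ne']
    refine (div_le_div₀ (by positivity) hnum
      (d := (κ * t ^ 2 / M) * (κ * sqNorm v / M)) (by positivity)
      (mul_le_mul hA hB (by positivity) hA0.le)).trans ?_
    have e : 3 * R * t * κ / M / ((κ * t ^ 2 / M) * (κ * sqNorm v / M))
        = 9 * M * R / (κ * sqNorm v * (3 * t)) := by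
      field_simp; ring
    rw [e]
    have h3 : R + supNorm v ≤ 3 * t := by linarith
    gcongr
  linarith

lemma sum_gTerm_sub_le {M κ E μ R : ℝ} (hM : 0 < M) (hR : 1 ≤ R) (hκ : 0 < κ)
    (hμ : μ = κ * R ^ 2) {τ τ' : ℤ × ℤ → ℝ} (hτ : ∀ w, -(κ * sqNorm w) ≤ τ w)
    (hττ' : ∀ w, τ w ≤ τ' w) (v : ℤ × ℤ) :
    ∑ w ∈ latticeDisc R, (gTerm M κ E μ w (τ w) (w + v) - gTerm M κ E μ 0 (τ' w) (w + v))
      ≤ (162 * M * R ^ 3 / κ) / (supNorm v * (R + supNorm v) ^ 2) := by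
  classical
  have hR0 : 0 < R := by linarith
  have hsub : exitSet R v ⊆ latticeDisc R := Finset.filter_subset _ _
  rw [← Finset.sum_subset hsub fun w hw hw' => ?_]
  · refine (Finset.sum_le_card_nsmul _ _
      (9 * M * R / (κ * supNorm v ^ 2 * (R + supNorm v))) fun w hw => ?_).trans ?_
    · obtain ⟨h1, h2⟩ := mem_exitSet.mp hw
      exact gTerm_sub_le hM hR0 hκ hμ h1 h2 (hτ w) (hττ' w)
    · rw [nsmul_eq_mul]
      refine (mul_le_mul_of_nonneg_right (card_exitSet_le hR v) (by positivity)).trans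
        (le_of_eq ?_)
      rcases eq_or_ne (supNorm v) 0 with h | h
      · simp [h]
      · have : (0 : ℝ) < supNorm v := by exact_mod_cast Nat.pos_of_ne_zero h
        field_simp; ring
  · rw [mem_exitSet, not_and, not_not] at hw'
    exact gTerm_sub_eq_zero hR0.le hκ hμ (hw' hw) _ _

lemma sum_tsum_gTerm_sub_le {M κ E μ R : ℝ} (hM : 0 < M) (hR : 1 ≤ R) (hκ : 0 < κ)
    (hE : 0 ≤ E) (hμ : μ = κ * R ^ 2) {τ τ' : ℤ × ℤ → ℝ}
    (hτ : ∀ w, -(κ * sqNorm w) ≤ τ w) (hττ' : ∀ w, τ w ≤ τ' w) :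
    ∑ w ∈ latticeDisc R,
        (∑' z, gTerm M κ E μ w (τ w) z - ∑' z, gTerm M κ E μ 0 (τ' w) z)
      ≤ 1296 * M * R ^ 2 / κ := by
  have hR0 : 0 < R := by linarith
  have hμ0 : 0 ≤ μ := by rw [hμ]; positivity
  have hS : ∀ w : ℤ × ℤ, Summable fun v =>
      gTerm M κ E μ w (τ w) (w + v) - gTerm M κ E μ 0 (τ' w) (w + v) := fun w =>
    (Equiv.addLeft w).summable_iff.mpr
      ((summable_gTerm hM hκ hE hμ0 w (τ w)).sub (summable_gTerm hM hκ hE hμ0 0 (τ' w)))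
  have h : ∀ w ∈ latticeDisc R,
      ∑' z, gTerm M κ E μ w (τ w) z - ∑' z, gTerm M κ E μ 0 (τ' w) z
        = ∑' v, (gTerm M κ E μ w (τ w) (w + v) - gTerm M κ E μ 0 (τ' w) (w + v)) := by
    intro w _
    rw [← (summable_gTerm hM hκ hE hμ0 w (τ w)).tsum_sub
      (summable_gTerm hM hκ hE hμ0 0 (τ' w))]
    exact ((Equiv.addLeft w).tsum_eq _).symm
  rw [Finset.sum_congr rfl h, ← Summable.tsum_finsetSum fun w _ => hS w]
  have hc : 0 ≤ 162 * M * R ^ 3 / κ := by positivity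
  refine ((summable_sum fun w _ => hS w).tsum_le_tsum
    (fun v => sum_gTerm_sub_le hM hR hκ hμ hτ hττ' v) (summable_supNorm hc hR0)).trans
    ((tsum_supNorm_le hc hR0).trans (le_of_eq ?_))
  field_simp; ring

theorem stmt_17 (M : ℝ) (hM : 1 < M) :
    ∃ c₀ C : ℝ, 0 < c₀ ∧ 0 < C ∧
      ∀ L μ E_B eP lam : ℝ, 0 < L → 0 < μ → E_B < 0 →
        1 ≤ L ^ 2 * |E_B| → c₀ ≤ μ / |E_B| →
        eP < 0 → PolaronEq M L E_B μ eP → lam ≤ E0 L μ + eP →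
        (1 / L ^ 2) * (∑' z : ℤ × ℤ,
            if nsq (kvec L z) ≤ μ then
              Gfun M L E_B μ (kvec L z) (-eP - nsq (kvec L z))
                - Gfun M L E_B μ 0 (E0 L μ - nsq (kvec L z) - lam)
            else 0) ≤ C * μ := by
  refine ⟨4 * Real.pi ^ 2, 1296 * M, by positivity, by positivity, ?_⟩
  intro L μ E_B eP lam hL hμ hE hLE hc he _ hlam
  have hM0 : 0 < M := by linarith
  have hE' : 0 < |E_B| := abs_pos.mpr hE.ne
  set κ := (2 * Real.pi / L) ^ 2 with hκdef
  have hκ : 0 < κ := by positivity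
  have hκL : κ * L ^ 2 = 4 * Real.pi ^ 2 := by rw [hκdef]; field_simp; ring
  set R := √(μ / κ) with hRdef
  have hR2 : R ^ 2 = μ / κ := Real.sq_sqrt (by positivity)
  have hμR : μ = κ * R ^ 2 := by rw [hR2]; field_simp
  have hR1 : 1 ≤ R := by
    rw [hRdef, Real.one_le_sqrt, one_le_div hκ]
    rw [le_div_iff₀ hE'] at hc
    have h1 : κ * 1 ≤ κ * (L ^ 2 * |E_B|) := mul_le_mul_of_nonneg_left hLE hκ.le
    rw [← mul_assoc, hκL] at h1
    linarith
  have hdisc : ∀ z, nsq (kvec L z) ≤ μ ↔ z ∈ latticeDisc R := by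
    intro z
    rw [mem_latticeDisc (Real.sqrt_nonneg _), nsq_kvec, ← hκdef, hR2, le_div_iff₀ hκ, mul_comm]
  have hsum := tsum_eq_sum (L := SummationFilter.unconditional _)
    (s := latticeDisc R) (f := fun z : ℤ × ℤ =>
    if nsq (kvec L z) ≤ μ then
      Gfun M L E_B μ (kvec L z) (-eP - nsq (kvec L z))
        - Gfun M L E_B μ 0 (E0 L μ - nsq (kvec L z) - lam)
    else 0) (fun z hz => if_neg (by rwa [hdisc]))
  rw [hsum, Finset.sum_congr rfl (fun z hz => if_pos ((hdisc z).mpr hz))]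
  have hG0 : ∀ τ, Gfun M L E_B μ 0 τ = (1 / L ^ 2) * ∑' z, gTerm M κ |E_B| μ 0 τ z := by
    intro τ
    rw [← kvec_zero L]
    exact Gfun_kvec M L E_B μ 0 τ
  simp only [Gfun_kvec, hG0, ← hκdef, nsq_kvec, ← mul_sub, ← Finset.mul_sum]
  have hmain := sum_tsum_gTerm_sub_le (M := M) (κ := κ) (E := |E_B|) (μ := μ) (R := R)
    (τ := fun w => -eP - κ * sqNorm w) (τ' := fun w => E0 L μ - κ * sqNorm w - lam)
    hM0 hR1 hκ hE'.le hμR (fun w => by linarith) (fun w => by linarith)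
  have hL2 : 0 ≤ 1 / L ^ 2 := by positivity
  refine (mul_le_mul_of_nonneg_left (mul_le_mul_of_nonneg_left hmain hL2) hL2).trans ?_
  have e : 1 / L ^ 2 * (1 / L ^ 2 * (1296 * M * R ^ 2 / κ))
      = 1296 * M * μ / (κ * L ^ 2) ^ 2 := by
    rw [hR2]; field_simp
  rw [e, hκL]
  refine div_le_self (by positivity) ?_
  have : (1 : ℝ) ≤ 4 * Real.pi ^ 2 := by nlinarith [Real.pi_gt_three]
  nlinarith
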